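/- Let C be a submodule of R^n (a linear code) and define the weight enumerator W(C;X,Y) = Σ_{c∈C} X^{n−wt(c)} Y^{wt(c)}. Then for all X, Y ∈ ℂ the MacWilliams identity holds: W(C;X,Y) = (1/|C^⊥|) · W(C^⊥; X + (|R|−1)Y, X−Y). -/

import Mathlib

open scoped BigOperators

/-- Dot product on `Fin n → R`. -/
def dotP {R : Type*} [CommRing R] {n : ℕ} (x y : Fin n → R) : R := ∑ i, x i * y i

/-- The orthogonal (dual) of a subset of `Fin n → R`, as a submodule. -/
def perp {R : Type*} [CommRing R] {n : ℕ} (B : Set (Fin n → R)) :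
    Submodule R (Fin n → R) where
  carrier := {y | ∀ x ∈ B, dotP x y = 0}
  add_mem' := by
    intro y z hy hz x hx
    have h1 := hy x hx
    have h2 := hz x hx
    simp only [dotP, Set.mem_setOf_eq, Pi.add_apply, mul_add, Finset.sum_add_distrib] at *
    rw [h1, h2, add_zero]
  zero_mem' := by
    intro x hx
    simp [dotP]
  smul_mem' := by
    intro c y hy x hx
    have h1 := hy x hx
    simp only [dotP, Set.mem_setOf_eq] at *
    have h2 : ∑ i, x i * (c • y) i = c * ∑ i, x i * y i := by
      rw [Finset.mul_sum]
      refine Finset.sum_congr rfl fun i _ => ?_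
      simp only [Pi.smul_apply, smul_eq_mul]
      ring
    rw [h2, h1, mul_zero]

/-- The Frobenius property of a finite commutative ring: for every submodule `D` of `R^k`,
`D^⊥⊥ = D` and `|D| ⬝ |D^⊥| = |R|^k`. -/
def FrobeniusProperty (R : Type*) [CommRing R] : Prop :=
  ∀ (k : ℕ) (D : Submodule R (Fin k → R)),
    perp ((perp (D : Set (Fin k → R)) : Submodule R (Fin k → R)) : Set (Fin k → R)) = D ∧
    Nat.card D * Nat.card (perp (D : Set (Fin k → R))) = Nat.card R ^ k

/-- `ε` is a generating additive character of `R`. -/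
def IsGenChar (R : Type*) [CommRing R] (ε : R → ℂ) : Prop :=
  (∀ a b, ε (a + b) = ε a * ε b) ∧ ε 0 = 1 ∧ (∀ x, ε x ≠ 0) ∧
  ∀ χ : R → ℂ, (∀ a b, χ (a + b) = χ a * χ b) → (∀ x, χ x ≠ 0) →
    ∃ r : R, ∀ x, χ x = ε (r * x)

/-- A parity check system `(H|S)` over `R`. -/
def IsPCS {R : Type*} [CommRing R] {m n s : ℕ} (H : Matrix (Fin m) (Fin n) R)
    (S : Matrix (Fin m) (Fin s) R) : Prop :=
  (∀ i j, ∃ x : Fin n → R, dotP (H i) x = S i j) ∧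
  (∀ j j' : Fin s, (∀ i, S i j = S i j') → j = j') ∧
  (∀ r r' : Fin m → R, ∑ i, r i • H i = ∑ i, r' i • H i →
    ∑ i, r i • S i = ∑ i, r' i • S i)

/-- The code associated with a parity check system `(H|S)`. -/
def codeOf {R : Type*} [CommRing R] {m n s : ℕ} (H : Matrix (Fin m) (Fin n) R)
    (S : Matrix (Fin m) (Fin s) R) : Set (Fin n → R) :=
  {x | ∃ j : Fin s, H.mulVec x = fun i => S i j}

/-- The minimum (Hamming) distance of a code. -/
noncomputable def minDist {R : Type*} [CommRing R] [DecidableEq R] {n : ℕ} (C : Set (Fin n → R)) : ℕ :=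
  sInf {d | ∃ c ∈ C, ∃ c' ∈ C, c ≠ c' ∧ hammingDist c c' = d}

section MacWilliams

variable {R : Type*} [CommRing R] {n : ℕ}

lemma dotP_comm (x y : Fin n → R) : dotP x y = dotP y x := by
  simp only [dotP, mul_comm]

lemma dotP_add (x y z : Fin n → R) : dotP x (y + z) = dotP x y + dotP x z := by
  simp only [dotP, Pi.add_apply, mul_add, Finset.sum_add_distrib]

lemma dotP_zero (x : Fin n → R) : dotP x 0 = 0 := by
  simp [dotP]

lemma dotP_smul (r : R) (x y : Fin n → R) : dotP x (r • y) = r * dotP x y := by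
  simp only [dotP, Pi.smul_apply, smul_eq_mul, Finset.mul_sum, mul_left_comm]

lemma mem_perp {B : Set (Fin n → R)} {y : Fin n → R} :
    y ∈ perp B ↔ ∀ x ∈ B, dotP x y = 0 := Iff.rfl

/-- A generating additive character on a finite ring is primitive: `r ↦ ε (r * ·)` is a surjection
between finite sets of the same size, hence injective. -/
lemma IsGenChar.exists_isPrimitive [Finite R] {ε : R → ℂ} (h : IsGenChar R ε) :
    ∃ ψ : AddChar R ℂ, ψ.IsPrimitive := by
  cases nonempty_fintype R
  obtain ⟨h_add, h_zero, -, h_gen⟩ := h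
  let ψ : AddChar R ℂ :=
    { toFun := ε, map_zero_eq_one' := h_zero, map_add_eq_mul' := h_add }
  have hsurj : Function.Surjective (AddChar.mulShift ψ) := fun χ => by
    obtain ⟨r, hr⟩ := h_gen χ (AddChar.map_add_eq_mul χ) fun x => (χ.val_isUnit x).ne_zero
    exact ⟨r, DFunLike.ext _ _ fun x => (hr x).symm⟩
  have hinj : Function.Injective (AddChar.mulShift ψ) :=
    ((Fintype.bijective_iff_surjective_and_card _).2 ⟨hsurj, AddChar.card_eq.symm⟩).1
  exact ⟨ψ, fun a ha h1 => ha (hinj (h1.trans (AddChar.mulShift_zero ψ).symm))⟩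

/-- The Hamming weight monomial as a product over coordinates. -/
lemma pow_mul_pow_hammingNorm_eq_prod [DecidableEq R] (X Y : ℂ) (c : Fin n → R) :
    X ^ (n - hammingNorm c) * Y ^ hammingNorm c = ∏ i, if c i = 0 then X else Y := by
  have h := Finset.card_filter_add_card_filter_not (s := (Finset.univ : Finset (Fin n)))
    (fun i => c i = 0)
  rw [Finset.card_univ, Fintype.card_fin] at h
  rw [Finset.prod_ite, Finset.prod_const, Finset.prod_const, hammingNorm]
  congr 2
  exact Nat.sub_eq_of_eq_add h.symm

variable {ψ : AddChar R ℂ}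

/-- Orthogonality relation for a primitive character on a submodule. -/
lemma sum_addChar_dotP (hψ : ψ.IsPrimitive) (D : Submodule R (Fin n → R)) [Fintype D]
    (v : Fin n → R) [Decidable (v ∈ perp (D : Set (Fin n → R)))] :
    ∑ u : D, ψ (dotP v u) =
      if v ∈ perp (D : Set (Fin n → R)) then (Nat.card D : ℂ) else 0 := by
  classical
  let χ : AddChar D ℂ :=
    { toFun := fun u => ψ (dotP v u)
      map_zero_eq_one' := by simp [dotP_zero]
      map_add_eq_mul' := fun a b => by
        rw [Submodule.coe_add, dotP_add, AddChar.map_add_eq_mul] }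
  have hχ : χ = 0 ↔ v ∈ perp (D : Set (Fin n → R)) := by
    refine ⟨fun h u hu => ?_, fun h => DFunLike.ext _ _ fun u => ?_⟩
    · by_contra hne
      rw [dotP_comm] at hne
      refine hψ hne (DFunLike.ext _ _ fun r => ?_)
      have := DFunLike.congr_fun h ⟨r • u, D.smul_mem r hu⟩
      simpa [χ, dotP_smul, mul_comm] using this
    · change ψ (dotP v u) = 1
      rw [dotP_comm, mem_perp.1 h u u.2, AddChar.map_zero_eq_one]
  have h := AddChar.sum_eq_ite χ
  simp only [hχ] at h
  rw [Nat.card_eq_fintype_card]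
  exact h

variable [Fintype R] [DecidableEq R]

lemma sum_ite_mul_mulShift (hψ : ψ.IsPrimitive) (X Y : ℂ) (a : R) :
    ∑ t, (if t = 0 then X else Y) * ψ (t * a) =
      if a = 0 then X + ((Nat.card R : ℂ) - 1) * Y else X - Y := by
  have h : ∀ t : R, (if t = 0 then X else Y) * ψ (t * a) =
      (if t = 0 then X - Y else 0) + Y * ψ (t * a) := fun t => by
    split_ifs with ht
    · simp [ht]
    · simp
  rw [Finset.sum_congr rfl fun t _ => h t, Finset.sum_add_distrib, ← Finset.mul_sum,
    AddChar.sum_mulShift a hψ, Nat.card_eq_fintype_card]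
  split_ifs <;> simp
  ring

/-- The Fourier transform of the Hamming weight monomial. -/
lemma sum_prod_ite_mul_addChar (hψ : ψ.IsPrimitive) (X Y : ℂ) (u : Fin n → R) :
    ∑ v : Fin n → R, (∏ i, if v i = 0 then X else Y) * ψ (dotP v u) =
      ∏ i, if u i = 0 then X + ((Nat.card R : ℂ) - 1) * Y else X - Y := by
  simp_rw [← sum_ite_mul_mulShift hψ X Y]
  rw [Finset.prod_univ_sum, Fintype.piFinset_univ]
  refine Finset.sum_congr rfl fun v _ => ?_
  rw [Finset.prod_mul_distrib]
  congr 1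
  exact map_prod ψ.toMonoidHom (fun i => Multiplicative.ofAdd (v i * u i)) Finset.univ

/-- The Poisson summation formula for Hamming weight monomials. -/
lemma sum_submodule_prod_ite (hψ : ψ.IsPrimitive) (D : Submodule R (Fin n → R)) (X Y : ℂ) :
    ∑ᶠ u ∈ (D : Set (Fin n → R)),
        (∏ i, if u i = 0 then X + ((Nat.card R : ℂ) - 1) * Y else X - Y) =
      (Nat.card D : ℂ) * ∑ᶠ v ∈ (perp (D : Set (Fin n → R)) : Set (Fin n → R)),
        ∏ i, if v i = 0 then X else Y := by
  classical
  rw [finsum_mem_eq_toFinset_sum, finsum_mem_eq_toFinset_sum]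
  have hD (f : (Fin n → R) → ℂ) :
      ∑ u ∈ (D : Set (Fin n → R)).toFinset, f u = ∑ u : D, f u :=
    Finset.sum_subtype _ (fun u => by simp) f
  rw [hD]
  simp_rw [← sum_prod_ite_mul_addChar hψ X Y]
  rw [Finset.sum_comm]
  simp_rw [← Finset.mul_sum, sum_addChar_dotP hψ D, mul_ite, mul_zero]
  rw [← Finset.sum_filter, ← Finset.sum_mul, mul_comm]
  congr 2
  ext v
  simp only [Finset.mem_filter, Finset.mem_univ, true_and, Set.mem_toFinset, SetLike.mem_coe]

end MacWilliams

/-- the MacWilliams identity for a linear code `C` over `R`: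
`W(C;X,Y) = |C^⊥|⁻¹ · W(C^⊥; X + (|R|-1)Y, X - Y)`. -/
theorem macwilliams_identity {R : Type*} [CommRing R] [Fintype R] [DecidableEq R]
    {n : ℕ} (hFrob : FrobeniusProperty R)
    (hchar : ∃ ε : R → ℂ, IsGenChar R ε)
    (C : Submodule R (Fin n → R)) (X Y : ℂ) :
    ∑ᶠ c ∈ (C : Set (Fin n → R)), X ^ (n - hammingNorm c) * Y ^ hammingNorm c =
      ((Nat.card (perp (C : Set (Fin n → R))) : ℂ))⁻¹ *
        ∑ᶠ c ∈ ((perp (C : Set (Fin n → R)) : Submodule R (Fin n → R)) : Set (Fin n → R)),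
          (X + ((Nat.card R : ℂ) - 1) * Y) ^ (n - hammingNorm c) *
            (X - Y) ^ hammingNorm c := by
  obtain ⟨ε, hε⟩ := hchar
  obtain ⟨ψ, hψ⟩ := hε.exists_isPrimitive
  have hcard : (Nat.card (perp (C : Set (Fin n → R))) : ℂ) ≠ 0 :=
    Nat.cast_ne_zero.2 Nat.card_pos.ne'
  simp_rw [pow_mul_pow_hammingNorm_eq_prod]
  rw [sum_submodule_prod_ite hψ, (hFrob n C).1, inv_mul_cancel_left₀ hcard]
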